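/- arXiv:2410.14039 — 9 statements merged into one kernel-verified Lean document; each statement's English description precedes it below -/
import Mathlib

section
/- Let E be a finite-dimensional real inner product space and Φ ⊆ E \ {0} a finite crystallographic root system (possibly non-reduced). Let α ∈ Φ be a root whose irreducible component Φ₀ has rank at least 2. Then span_ℝ(Φ₀) is contained in the sum of the subspaces span_ℝ(Ψ), where Ψ ranges over all rank-2 irreducible saturated root subsystems of Φ containing α. -/
open scoped RealInnerProductSpace

variable {E : Type*} [NormedAddCommGroup E] [InnerProductSpace ℝ E]

/-- The reflection of `x` in the hyperplane orthogonal to `α`. -/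
noncomputable def rootReflection (α x : E) : E :=
  x - (2 * ⟪x, α⟫ / ⟪α, α⟫) • α

/-- `Φ` is a (possibly non-reduced) crystallographic root system in `E`. -/
structure IsRootSystem (Φ : Set E) : Prop where
  finite : Φ.Finite
  ne_zero : ∀ α ∈ Φ, α ≠ 0
  crystallographic : ∀ α ∈ Φ, ∀ β ∈ Φ, ∃ n : ℤ, 2 * ⟪β, α⟫ / ⟪α, α⟫ = (n : ℝ)
  reflect_mem : ∀ α ∈ Φ, ∀ β ∈ Φ, rootReflection α β ∈ Φ

/-- Two roots of `Φ` are related if they both belong to `Φ` and are non-orthogonal. -/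
def chainRel (Φ : Set E) (a b : E) : Prop := a ∈ Φ ∧ b ∈ Φ ∧ ⟪a, b⟫ ≠ 0

/-- The irreducible component of `Φ` containing the root `α`: the set of roots connected to `α`
by a chain of pairwise non-orthogonal roots. -/
def component (Φ : Set E) (α : E) : Set E := {β | Relation.TransGen (chainRel Φ) α β}

/-- A subspace `V ≤ span ℝ Φ` is `k`-small if for every irreducible component `Ψ` of `Φ`
the codimension of `V ∩ span ℝ Ψ` in `span ℝ Ψ` is at least `k`. -/
def IsSmall (Φ : Set E) (V : Submodule ℝ E) (k : ℕ) : Prop :=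
  ∀ α ∈ Φ,
    Module.finrank ℝ ↥(V ⊓ Submodule.span ℝ (component Φ α)) + k ≤
      Module.finrank ℝ ↥(Submodule.span ℝ (component Φ α))

/-- A saturated root subsystem of `Φ`: the intersection of `Φ` with a linear subspace. -/
def IsSaturatedSubsystem (Φ Ψ : Set E) : Prop :=
  ∃ U : Submodule ℝ E, Ψ = Φ ∩ ↑U

/-- A set of roots is irreducible if it is nonempty and any two of its roots are joined by a
chain of pairwise non-orthogonal roots inside it. -/
def IsIrreducibleSubsystem (Ψ : Set E) : Prop :=
  Ψ.Nonempty ∧ ∀ a ∈ Ψ, ∀ b ∈ Ψ, Relation.TransGen (chainRel Ψ) a b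

/-- The rank of a set of roots: the dimension of its real span. -/
noncomputable def rootRank (Ψ : Set E) : ℕ :=
  Module.finrank ℝ ↥(Submodule.span ℝ Ψ)

/-- A root orthogonal to `α` lies in the span of the roots non-orthogonal to `α`, or is orthogonal
to that span. -/
theorem mem_span_nonorthogonal_of_inner_ne_zero {Φ : Set E} (hΦ : IsRootSystem Φ) {α β γ : E}
    (hγ : γ ∈ Φ) (hβ : β ∈ Submodule.span ℝ {δ ∈ Φ | ⟪δ, α⟫ ≠ 0}) (hβγ : ⟪β, γ⟫ ≠ 0) :
    γ ∈ Submodule.span ℝ {δ ∈ Φ | ⟪δ, α⟫ ≠ 0} := by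
  by_contra hγT
  have hγα : ⟪γ, α⟫ = 0 := by
    by_contra h
    exact hγT (Submodule.subset_span ⟨hγ, h⟩)
  refine hβγ ?_
  induction hβ using Submodule.span_induction with
  | mem δ hδ =>
    by_contra hδγ
    have hr : rootReflection γ δ ∈ Submodule.span ℝ {δ ∈ Φ | ⟪δ, α⟫ ≠ 0} := by
      refine Submodule.subset_span ⟨hΦ.reflect_mem γ hγ δ hδ.1, ?_⟩
      simpa [rootReflection, inner_sub_left, inner_smul_left, hγα] using hδ.2
    have hc : 2 * ⟪δ, γ⟫ / ⟪γ, γ⟫ ≠ 0 :=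
      div_ne_zero (mul_ne_zero two_ne_zero hδγ) (inner_self_ne_zero.mpr (hΦ.ne_zero γ hγ))
    have hs := Submodule.sub_mem _ (Submodule.subset_span hδ) hr
    rw [rootReflection, sub_sub_cancel] at hs
    exact hγT ((Submodule.smul_mem_iff _ hc).mp hs)
  | zero => simp
  | add x y _ _ hx hy =>
    by_contra h
    rw [inner_add_left] at h
    by_cases hx0 : ⟪x, γ⟫ = 0
    · exact h (by rw [hx0, hy (by simpa [hx0] using h), add_zero])
    · exact hx0 (hx hx0)
  | smul a x _ hx =>
    by_contra h
    rw [real_inner_smul_left] at h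
    exact right_ne_zero_of_mul h (hx (right_ne_zero_of_mul h))

/-- The irreducible component of a root `α` lies in the span of the roots non-orthogonal to `α`. -/
theorem component_subset_span_nonorthogonal {Φ : Set E} (hΦ : IsRootSystem Φ) {α : E}
    (hα : α ∈ Φ) :
    component Φ α ⊆ Submodule.span ℝ {δ ∈ Φ | ⟪δ, α⟫ ≠ 0} := by
  intro β hβ
  have hαT : α ∈ Submodule.span ℝ {δ ∈ Φ | ⟪δ, α⟫ ≠ 0} :=
    Submodule.subset_span ⟨hα, inner_self_ne_zero.mpr (hΦ.ne_zero α hα)⟩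
  induction hβ with
  | single h => exact mem_span_nonorthogonal_of_inner_ne_zero hΦ h.2.1 hαT h.2.2
  | tail _ h ih => exact mem_span_nonorthogonal_of_inner_ne_zero hΦ h.2.1 ih h.2.2

/-- The roots in the plane spanned by two non-orthogonal roots form an irreducible subsystem. -/
theorem isIrreducibleSubsystem_inter_span_pair {Φ : Set E} (hΦ : IsRootSystem Φ) {α β : E}
    (hα : α ∈ Φ) (hβ : β ∈ Φ) (hβα : ⟪β, α⟫ ≠ 0) :
    IsIrreducibleSubsystem (Φ ∩ ↑(Submodule.span ℝ {α, β})) := by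
  set Ψ : Set E := Φ ∩ ↑(Submodule.span ℝ {α, β})
  have hαΨ : α ∈ Ψ := ⟨hα, Submodule.subset_span (by simp)⟩
  have hβΨ : β ∈ Ψ := ⟨hβ, Submodule.subset_span (by simp)⟩
  have symm : ∀ {a b : E}, chainRel Ψ a b → chainRel Ψ b a := fun h =>
    ⟨h.2.1, h.1, by rw [real_inner_comm]; exact h.2.2⟩
  have key : ∀ γ ∈ Ψ, Relation.TransGen (chainRel Ψ) γ α := by
    intro γ hγ
    by_cases h1 : ⟪γ, α⟫ = 0
    · have h2 : ⟪γ, β⟫ ≠ 0 := by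
        intro h2
        obtain ⟨a, b, hab⟩ := Submodule.mem_span_pair.mp hγ.2
        refine hΦ.ne_zero γ hγ.1 (inner_self_eq_zero (𝕜 := ℝ).mp ?_)
        nth_rewrite 2 [← hab]
        rw [inner_add_right, real_inner_smul_right, real_inner_smul_right, h1, h2]
        simp
      exact .tail (.single ⟨hγ, hβΨ, h2⟩) ⟨hβΨ, hαΨ, hβα⟩
    · exact .single ⟨hγ, hαΨ, h1⟩
  have key' : ∀ γ ∈ Ψ, Relation.TransGen (chainRel Ψ) α γ := fun γ hγ =>
    Relation.TransGen.mono (fun _ _ h => symm h) _ _ (Relation.TransGen.swap _ _ (key γ hγ))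
  exact ⟨⟨α, hαΨ⟩, fun a ha b hb => (key a ha).trans (key' b hb)⟩

/-- The roots in the plane spanned by two roots span that plane. -/
theorem span_inter_span_pair {Φ : Set E} {α β : E} (hα : α ∈ Φ) (hβ : β ∈ Φ) :
    Submodule.span ℝ (Φ ∩ ↑(Submodule.span ℝ {α, β})) = Submodule.span ℝ {α, β} := by
  refine le_antisymm (Submodule.span_le.mpr Set.inter_subset_right) (Submodule.span_mono ?_)
  intro x hx
  refine ⟨?_, Submodule.subset_span hx⟩
  rcases hx with rfl | rfl
  exacts [hα, hβ]

/-- If the irreducible component `Φ₀` of a root `α ∈ Φ` has rank at least `2`, then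
`span ℝ Φ₀` is contained in the sum of the spans of all rank-2 irreducible saturated root
subsystems of `Φ` containing `α`. -/
theorem span_component_le_sSup_rank_two [FiniteDimensional ℝ E]
    (Φ : Set E) (hΦ : IsRootSystem Φ) (α : E) (hα : α ∈ Φ)
    (hrank : 2 ≤ rootRank (component Φ α)) :
    Submodule.span ℝ (component Φ α) ≤
      sSup {W : Submodule ℝ E | ∃ Ψ : Set E, IsSaturatedSubsystem Φ Ψ ∧
        IsIrreducibleSubsystem Ψ ∧ rootRank Ψ = 2 ∧ α ∈ Ψ ∧ W = Submodule.span ℝ Ψ} := by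
  set S := sSup {W : Submodule ℝ E | ∃ Ψ : Set E, IsSaturatedSubsystem Φ Ψ ∧
    IsIrreducibleSubsystem Ψ ∧ rootRank Ψ = 2 ∧ α ∈ Ψ ∧ W = Submodule.span ℝ Ψ}
  have hα0 := hΦ.ne_zero α hα
  have plane : ∀ β ∈ Φ, ⟪β, α⟫ ≠ 0 → β ∉ Submodule.span ℝ {α} →
      Submodule.span ℝ {α, β} ≤ S := by
    intro β hβ hβα hβs
    refine le_sSup ⟨Φ ∩ ↑(Submodule.span ℝ {α, β}), ⟨_, rfl⟩,
      isIrreducibleSubsystem_inter_span_pair hΦ hα hβ hβα, ?_,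
      ⟨hα, Submodule.subset_span (by simp)⟩, (span_inter_span_pair hα hβ).symm⟩
    rw [rootRank, span_inter_span_pair hα hβ]
    have hli : LinearIndependent ℝ ![α, β] := by
      rw [LinearIndependent.pair_iff' hα0]
      intro a ha
      exact hβs (Submodule.mem_span_singleton.mpr ⟨a, ha⟩)
    have hcard := finrank_span_eq_card hli
    rwa [Matrix.range_cons_cons_empty, Fintype.card_fin] at hcard
  have hle : Submodule.span ℝ (component Φ α) ≤ Submodule.span ℝ {δ ∈ Φ | ⟪δ, α⟫ ≠ 0} :=
    Submodule.span_le.mpr (component_subset_span_nonorthogonal hΦ hα)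
  obtain ⟨δ, ⟨hδ, hδα⟩, hδs⟩ : ∃ δ ∈ {δ ∈ Φ | ⟪δ, α⟫ ≠ 0}, δ ∉ Submodule.span ℝ {α} := by
    by_contra! h
    have h1 := Submodule.finrank_mono (hle.trans (Submodule.span_le.mpr h))
    rw [finrank_span_singleton hα0] at h1
    rw [rootRank] at hrank
    omega
  have hαS : α ∈ S := plane δ hδ hδα hδs (Submodule.subset_span (by simp))
  refine hle.trans (Submodule.span_le.mpr fun β hβ => ?_)
  by_cases hβs : β ∈ Submodule.span ℝ {α}
  · exact (Submodule.span_singleton_le_iff_mem α S).mpr hαS hβs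
  · exact plane β hβ.1 hβ.2 hβs (Submodule.subset_span (by simp))
end

section
/- Let E be a finite-dimensional real inner product space and Φ ⊆ E \ {0} a finite crystallographic root system (possibly non-reduced). If V ⊆ span_ℝ(Φ) is a 1-small subspace and α ∈ Φ ∩ V, then there exists an irreducible saturated root subsystem Ψ ⊆ Φ of rank 2 with α ∈ Ψ such that span_ℝ(Ψ) ∩ V = ℝα. -/
open scoped RealInnerProductSpace

variable {E : Type*} [NormedAddCommGroup E] [InnerProductSpace ℝ E]

/-- If a chain of roots leads from `a` to a root outside `V`, then `a` lies outside `V` or is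
non-orthogonal to a root outside `V`. -/
theorem notMem_or_exists_inner_ne_zero {Φ : Set E} (hΦ : IsRootSystem Φ) {V : Submodule ℝ E}
    {a d : E} (h : Relation.TransGen (chainRel Φ) a d) (hd : d ∉ V) :
    a ∉ V ∨ ∃ β ∈ Φ, β ∉ V ∧ ⟪β, a⟫ ≠ 0 := by
  induction h using Relation.TransGen.head_induction_on with
  | single h => exact Or.inr ⟨d, h.2.1, hd, by rw [real_inner_comm]; exact h.2.2⟩
  | @head a c h _ ih =>
    obtain ⟨-, hc, hac⟩ := h
    rw [real_inner_comm] at hac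
    by_cases hcV : c ∈ V
    · obtain ⟨β, hβ, hβV, hβc⟩ := ih.resolve_left (not_not_intro hcV)
      by_cases hβa : ⟪β, a⟫ = 0
      · refine Or.inr ⟨rootReflection c β, hΦ.reflect_mem c hc β hβ, fun hmem => hβV ?_, ?_⟩
        · simpa [rootReflection] using V.add_mem hmem (V.smul_mem (2 * ⟪β, c⟫ / ⟪c, c⟫) hcV)
        · have hcc : ⟪c, c⟫ ≠ 0 := inner_self_ne_zero.mpr (hΦ.ne_zero c hc)
          rw [rootReflection, inner_sub_left, real_inner_smul_left, hβa, zero_sub]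
          exact neg_ne_zero.mpr
            (mul_ne_zero (div_ne_zero (mul_ne_zero two_ne_zero hβc) hcc) hac)
      · exact Or.inr ⟨β, hβ, hβV, hβa⟩
    · exact Or.inr ⟨c, hc, hcV, hac⟩

/-- A root lying in a `1`-small subspace `V` is non-orthogonal to some root outside `V`. -/
theorem IsSmall.exists_inner_ne_zero [FiniteDimensional ℝ E] {Φ : Set E} (hΦ : IsRootSystem Φ)
    {V : Submodule ℝ E} (hsmall : IsSmall Φ V 1) {α : E} (hα : α ∈ Φ) (hαV : α ∈ V) :
    ∃ β ∈ Φ, β ∉ V ∧ ⟪β, α⟫ ≠ 0 := by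
  obtain ⟨d, hd, hdV⟩ : ∃ d ∈ component Φ α, d ∉ V := by
    by_contra! hcon
    have hle : Submodule.span ℝ (component Φ α) ≤ V := Submodule.span_le.mpr hcon
    have h := hsmall α hα
    rw [inf_eq_right.mpr hle] at h
    omega
  exact (notMem_or_exists_inner_ne_zero hΦ hd hdV).resolve_left (not_not_intro hαV)

/-- If `V` is a `1`-small subspace of `span ℝ Φ` and `α ∈ Φ ∩ V`, then there is a rank-2
irreducible saturated root subsystem `Ψ ⊆ Φ` containing `α` with `span ℝ Ψ ∩ V = ℝα`. -/
theorem exists_rank_two_subsystem_inf_eq [FiniteDimensional ℝ E]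
    (Φ : Set E) (hΦ : IsRootSystem Φ)
    (V : Submodule ℝ E) (hV : V ≤ Submodule.span ℝ Φ) (hsmall : IsSmall Φ V 1)
    (α : E) (hα : α ∈ Φ) (hαV : α ∈ V) :
    ∃ Ψ : Set E, IsSaturatedSubsystem Φ Ψ ∧ IsIrreducibleSubsystem Ψ ∧ rootRank Ψ = 2 ∧
      α ∈ Ψ ∧ Submodule.span ℝ Ψ ⊓ V = Submodule.span ℝ {α} := by
  obtain ⟨β, hβ, hβV, hβα⟩ := hsmall.exists_inner_ne_zero hΦ hα hαV
  have hspan : Submodule.span ℝ (Φ ∩ ↑(Submodule.span ℝ {α, β})) = Submodule.span ℝ {α, β} := by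
    refine le_antisymm (Submodule.span_le.mpr Set.inter_subset_right) (Submodule.span_mono ?_)
    rintro x (rfl | rfl)
    · exact ⟨hα, Submodule.subset_span (by simp)⟩
    · exact ⟨hβ, Submodule.subset_span (by simp)⟩
  refine ⟨Φ ∩ ↑(Submodule.span ℝ {α, β}), ⟨_, rfl⟩,
    isIrreducibleSubsystem_inter_span_pair hΦ hα hβ hβα, ?_,
    ⟨hα, Submodule.subset_span (by simp)⟩, ?_⟩
  · have hli : LinearIndependent ℝ ![α, β] := by
      rw [LinearIndependent.pair_iff' (hΦ.ne_zero α hα)]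
      rintro c rfl
      exact hβV (V.smul_mem c hαV)
    rw [rootRank, hspan, ← Matrix.range_cons_cons_empty α β ![], finrank_span_eq_card hli,
      Fintype.card_fin]
  · rw [hspan]
    apply le_antisymm
    · rintro v ⟨hv, hvV⟩
      obtain ⟨x, y, rfl⟩ := Submodule.mem_span_pair.mp hv
      have hy : y = 0 := by
        by_contra hy
        exact hβV ((V.smul_mem_iff hy).mp ((V.add_mem_iff_right (V.smul_mem x hαV)).mp hvV))
      simpa [hy] using Submodule.smul_mem _ x (Submodule.mem_span_singleton_self α)
    · rw [Submodule.span_singleton_le_iff_mem]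
      exact ⟨Submodule.subset_span (by simp), hαV⟩
end

section
/- Let E be a finite-dimensional real inner product space and Φ ⊆ E \ {0} a finite crystallographic root system (possibly non-reduced). Suppose V ⊆ span_ℝ(Φ) is a 2-small subspace, α ∈ Φ ∩ V, β, γ ∈ Φ \ V, the three roots α, β, γ are linearly independent, and (ℝα + ℝβ + ℝγ) ∩ V is two-dimensional. Then there exists an irreducible saturated root subsystem Ψ ⊆ Φ of rank 2 with γ ∈ Ψ such that ℝα + ℝβ + span_ℝ(Ψ) is four-dimensional and (span_ℝ(Ψ) + ℝα + ℝβ) ∩ V is still two-dimensional. -/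
open scoped RealInnerProductSpace

variable {E : Type*} [NormedAddCommGroup E] [InnerProductSpace ℝ E]

/-- The span of the roots non-orthogonal to a fixed root `γ` contains the whole irreducible
component of `γ`. -/
theorem IsRootSystem.component_subset_span {Φ : Set E} (hΦ : IsRootSystem Φ) {γ : E}
    (hγ : γ ∈ Φ) :
    component Φ γ ⊆ Submodule.span ℝ {η | η ∈ Φ ∧ ⟪γ, η⟫ ≠ 0} := by
  set U := Submodule.span ℝ {η | η ∈ Φ ∧ ⟪γ, η⟫ ≠ 0} with hU
  have hγU : γ ∈ U :=
    Submodule.subset_span ⟨hγ, inner_self_ne_zero.mpr (hΦ.ne_zero γ hγ)⟩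
  have step : ∀ δ ∈ U, ∀ ε, chainRel Φ δ ε → ε ∈ U := by
    rintro δ hδ ε ⟨-, hε, hδε⟩
    by_cases hγε : ⟪γ, ε⟫ = 0
    · obtain ⟨η, hη, hγη, hηε⟩ : ∃ η ∈ Φ, ⟪γ, η⟫ ≠ 0 ∧ ⟪η, ε⟫ ≠ 0 := by
        by_contra! h
        refine hδε ?_
        clear hδε
        induction hδ using Submodule.span_induction with
        | mem x hx => exact h x hx.1 hx.2
        | zero => exact inner_zero_left _
        | add x y _ _ hx hy => rw [inner_add_left, hx, hy, add_zero]
        | smul c x _ hx => rw [inner_smul_left, hx, mul_zero]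
      have hrefl : rootReflection ε η ∈ U := by
        refine Submodule.subset_span ⟨hΦ.reflect_mem ε hε η hη, ?_⟩
        rwa [rootReflection, inner_sub_right, inner_smul_right, hγε, mul_zero, sub_zero]
      have hηU : η ∈ U := Submodule.subset_span ⟨hη, hγη⟩
      have hmul : (2 * ⟪η, ε⟫ / ⟪ε, ε⟫) • ε ∈ U := by
        simpa [rootReflection] using U.sub_mem hηU hrefl
      refine (U.smul_mem_iff ?_).mp hmul
      exact div_ne_zero (mul_ne_zero two_ne_zero hηε)
        (inner_self_ne_zero.mpr (hΦ.ne_zero ε hε))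
    · exact Submodule.subset_span ⟨hε, hγε⟩
  intro δ hδ
  induction (show Relation.TransGen (chainRel Φ) γ δ from hδ) with
  | single h => exact step _ hγU _ h
  | tail h₁ h₂ ih => exact step _ (ih h₁) _ h₂

/-- The saturated subsystem spanned by two non-orthogonal roots is irreducible. -/
theorem IsRootSystem.isIrreducibleSubsystem_inter_span_pair {Φ : Set E} (hΦ : IsRootSystem Φ)
    {γ δ : E} (hγ : γ ∈ Φ) (hδ : δ ∈ Φ) (hγδ : ⟪γ, δ⟫ ≠ 0) :
    IsIrreducibleSubsystem (Φ ∩ (Submodule.span ℝ {γ, δ} : Submodule ℝ E)) := by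
  set Ψ : Set E := Φ ∩ (Submodule.span ℝ {γ, δ} : Submodule ℝ E)
  have hγΨ : γ ∈ Ψ := ⟨hγ, Submodule.subset_span (by simp)⟩
  have hδΨ : δ ∈ Ψ := ⟨hδ, Submodule.subset_span (by simp)⟩
  have symm : ∀ {a b}, chainRel Ψ a b → chainRel Ψ b a := fun ⟨ha, hb, h⟩ =>
    ⟨hb, ha, by rwa [real_inner_comm]⟩
  have rel : chainRel Ψ γ δ := ⟨hγΨ, hδΨ, hγδ⟩
  have key : ∀ a ∈ Ψ, chainRel Ψ a γ ∨ chainRel Ψ a δ := by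
    intro a ha
    by_contra! h
    have haγ : ⟪a, γ⟫ = 0 := by_contra fun h0 => h.1 ⟨ha, hγΨ, h0⟩
    have haδ : ⟪a, δ⟫ = 0 := by_contra fun h0 => h.2 ⟨ha, hδΨ, h0⟩
    obtain ⟨x, y, hxy⟩ := Submodule.mem_span_pair.mp ha.2
    refine hΦ.ne_zero a ha.1 (inner_self_eq_zero (𝕜 := ℝ).mp ?_)
    nth_rewrite 2 [← hxy]
    rw [inner_add_right, inner_smul_right, inner_smul_right, haγ, haδ, mul_zero, mul_zero,
      add_zero]
  have toγ : ∀ a ∈ Ψ, Relation.TransGen (chainRel Ψ) a γ := fun a ha =>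
    (key a ha).elim .single fun h => .tail (.single h) (symm rel)
  have fromγ : ∀ a ∈ Ψ, Relation.TransGen (chainRel Ψ) γ a := fun a ha =>
    (key a ha).elim (fun h => .single (symm h)) fun h => .tail (.single rel) (symm h)
  exact ⟨⟨γ, hγΨ⟩, fun a ha b hb => (toγ a ha).trans (fromγ b hb)⟩

/-- If `V` is `2`-small, `α ∈ Φ ∩ V`, `β, γ ∈ Φ \ V` with `α, β, γ` linearly independent and
`(ℝα + ℝβ + ℝγ) ∩ V` two-dimensional, then there is a rank-2 irreducible saturated root
subsystem `Ψ ⊆ Φ` with `γ ∈ Ψ` such that `ℝα + ℝβ + span ℝ Ψ` is four-dimensional and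
`(span ℝ Ψ + ℝα + ℝβ) ∩ V` is still two-dimensional. -/
theorem exists_rank_two_subsystem_through_gamma [FiniteDimensional ℝ E]
    (Φ : Set E) (hΦ : IsRootSystem Φ)
    (V : Submodule ℝ E) (hV : V ≤ Submodule.span ℝ Φ) (hsmall : IsSmall Φ V 2)
    (α β γ : E) (hα : α ∈ Φ) (hβ : β ∈ Φ) (hγ : γ ∈ Φ)
    (hαV : α ∈ V) (hβV : β ∉ (V : Set E)) (hγV : γ ∉ (V : Set E))
    (hind : LinearIndependent ℝ ![α, β, γ])
    (hdim : Module.finrank ℝ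
      ↥((Submodule.span ℝ {α} ⊔ Submodule.span ℝ {β} ⊔ Submodule.span ℝ {γ}) ⊓ V) = 2) :
    ∃ Ψ : Set E, IsSaturatedSubsystem Φ Ψ ∧ IsIrreducibleSubsystem Ψ ∧ rootRank Ψ = 2 ∧
      γ ∈ Ψ ∧
      Module.finrank ℝ
        ↥(Submodule.span ℝ {α} ⊔ Submodule.span ℝ {β} ⊔ Submodule.span ℝ Ψ) = 4 ∧
      Module.finrank ℝ
        ↥((Submodule.span ℝ Ψ ⊔ Submodule.span ℝ {α} ⊔ Submodule.span ℝ {β}) ⊓ V) = 2 := by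
  set W := Submodule.span ℝ {α} ⊔ Submodule.span ℝ {β} ⊔ Submodule.span ℝ {γ} with hW
  have hW3 : Module.finrank ℝ W = 3 := by
    have h := finrank_span_eq_card hind
    have hr : Submodule.span ℝ (Set.range ![α, β, γ]) = W := by
      rw [Matrix.range_cons, Matrix.range_cons_cons_empty, Submodule.span_union,
        Submodule.span_insert, hW, sup_assoc]
    rwa [hr, Fintype.card_fin] at h
  have hsup := Submodule.finrank_sup_add_finrank_inf_eq W V
  obtain ⟨δ, hδ, hγδ, hδV⟩ : ∃ δ ∈ Φ, ⟪γ, δ⟫ ≠ 0 ∧ δ ∉ W ⊔ V := by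
    by_contra! h
    have hle : Submodule.span ℝ (component Φ γ) ≤ W ⊔ V :=
      (Submodule.span_le.mpr (hΦ.component_subset_span hγ)).trans
        (Submodule.span_le.mpr fun η hη => h η hη.1 hη.2)
    have h1 := Submodule.finrank_mono (sup_le (le_sup_right : V ≤ W ⊔ V) hle)
    have h2 := Submodule.finrank_sup_add_finrank_inf_eq V (Submodule.span ℝ (component Φ γ))
    have h3 := hsmall γ hγ
    omega
  have hδ0 : δ ≠ 0 := hΦ.ne_zero δ hδ
  have hγW : γ ∈ W := le_sup_right (a := Submodule.span ℝ {α} ⊔ Submodule.span ℝ {β})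
    (Submodule.mem_span_singleton_self γ)
  have hspan : Submodule.span ℝ (Φ ∩ (Submodule.span ℝ {γ, δ} : Submodule ℝ E)) =
      Submodule.span ℝ {γ, δ} := by
    refine le_antisymm (Submodule.span_le.mpr Set.inter_subset_right)
      (Submodule.span_mono (Set.insert_subset_iff.mpr ⟨⟨hγ, ?_⟩,
        Set.singleton_subset_iff.mpr ⟨hδ, ?_⟩⟩)) <;>
    exact Submodule.subset_span (by simp)
  have disjoint_of_le : ∀ X ≤ W ⊔ V, X ⊓ Submodule.span ℝ {δ} = ⊥ := fun X hX =>
    ((Submodule.disjoint_span_singleton' hδ0).mpr fun h => hδV (hX h)).eq_bot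
  refine ⟨Φ ∩ (Submodule.span ℝ {γ, δ} : Submodule ℝ E), ⟨_, rfl⟩,
    hΦ.isIrreducibleSubsystem_inter_span_pair hγ hδ hγδ, ?_,
    ⟨hγ, Submodule.subset_span (by simp)⟩, ?_, ?_⟩
  · have h := Submodule.finrank_sup_add_finrank_inf_eq (Submodule.span ℝ {γ})
      (Submodule.span ℝ {δ})
    rw [disjoint_of_le _ ((Submodule.span_singleton_le_iff_mem _ _).mpr
      (le_sup_left (a := W) hγW)), finrank_bot, finrank_span_singleton (hΦ.ne_zero γ hγ),
      finrank_span_singleton hδ0] at h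
    rw [rootRank, hspan, Submodule.span_insert]
    exact h
  · have h := Submodule.finrank_sup_add_finrank_inf_eq W (Submodule.span ℝ {δ})
    rw [disjoint_of_le _ le_sup_left, finrank_bot, hW3, finrank_span_singleton hδ0] at h
    rw [hspan, Submodule.span_insert, ← sup_assoc]
    exact h
  · rw [hspan, Submodule.span_insert, ← hdim]
    have hWδ : Submodule.span ℝ {γ} ⊔ Submodule.span ℝ {δ} ⊔ Submodule.span ℝ {α} ⊔
        Submodule.span ℝ {β} = W ⊔ Submodule.span ℝ {δ} := by
      rw [hW]
      ac_rfl
    rw [hWδ]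
    refine congrArg (fun X : Submodule ℝ E => Module.finrank ℝ X)
      (le_antisymm (fun x hx => ⟨?_, hx.2⟩) (inf_le_inf_right V le_sup_left))
    obtain ⟨w, hw, d, hd, rfl⟩ := Submodule.mem_sup.mp hx.1
    have hdV : d ∈ W ⊔ V := by
      have := (W ⊔ V).sub_mem (Submodule.mem_sup_right (S := W) hx.2)
        (Submodule.mem_sup_left (T := V) hw)
      simpa using this
    have hd0 : d ∈ (W ⊔ V) ⊓ Submodule.span ℝ {δ} := ⟨hdV, hd⟩
    rw [disjoint_of_le _ le_rfl, Submodule.mem_bot] at hd0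
    simpa [hd0] using hw
end

section
/- Let f : X → G be a surjective group homomorphism whose kernel is contained in the center of X, and suppose X is perfect. Then there exists a unique function ⟨·,·⟩ : G × G → X such that ⟨f(x), f(y)⟩ = x * y * x⁻¹ * y⁻¹ for all x, y ∈ X; moreover this function satisfies f(⟨g, h⟩) = g * h * g⁻¹ * h⁻¹ for all g, h ∈ G. -/
open Subgroup commutatorElement in
/-- The commutator of two elements depends only on their images under a homomorphism with
central kernel. -/
theorem MonoidHom.commutatorElement_eq_of_ker_le_center {X G : Type*} [Group X] [Group G]
    (f : X →* G) (hker : f.ker ≤ center X) {x x' y y' : X} (hx : f x = f x') (hy : f y = f y') :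
    ⁅x, y⁆ = ⁅x', y'⁆ := by
  have left {a a' : X} (b : X) (h : f a = f a') : ⁅a, b⁆ = ⁅a', b⁆ := by
    obtain ⟨z, hz, rfl⟩ : ∃ z ∈ center X, a = a' * z :=
      ⟨a'⁻¹ * a, hker (by simp [MonoidHom.mem_ker, h]), by group⟩
    have hzb : z * b * z⁻¹ = b := by rw [← mem_center_iff.mp hz b, mul_inv_cancel_right]
    calc ⁅a' * z, b⁆ = a' * (z * b * z⁻¹) * a'⁻¹ * b⁻¹ := by
          simp only [commutatorElement_def]; group
      _ = ⁅a', b⁆ := by rw [hzb, commutatorElement_def]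
  rw [left y hx, ← commutatorElement_inv, left x' hy, commutatorElement_inv]

/-- If `f : X → G` is a surjective homomorphism with central kernel and `X` is perfect, then
there is a unique map `⟨·,·⟩ : G × G → X` with `⟨f x, f y⟩ = [x, y]`, and it satisfies
`f ⟨g, h⟩ = [g, h]`. -/
theorem exists_unique_commutator_lift {X G : Type*} [Group X] [Group G] (f : X →* G)
    (hsurj : Function.Surjective f) (hker : f.ker ≤ Subgroup.center X)
    (hperf : commutator X = ⊤) :
    (∃! br : G × G → X, ∀ x y : X, br (f x, f y) = x * y * x⁻¹ * y⁻¹) ∧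
      ∀ br : G × G → X, (∀ x y : X, br (f x, f y) = x * y * x⁻¹ * y⁻¹) →
        ∀ g h : G, f (br (g, h)) = g * h * g⁻¹ * h⁻¹ := by
  obtain ⟨s, hs⟩ := hsurj.hasRightInverse
  refine ⟨⟨fun p => s p.1 * s p.2 * (s p.1)⁻¹ * (s p.2)⁻¹, ?_, ?_⟩, ?_⟩
  · intro x y
    exact f.commutatorElement_eq_of_ker_le_center hker
      (hs _) (hs _)
  · rintro br hbr
    funext ⟨g, h⟩
    simpa only [hs _] using hbr (s g) (s h)
  · intro br hbr g h
    obtain ⟨x, rfl⟩ := hsurj g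
    obtain ⟨y, rfl⟩ := hsurj h
    simp only [hbr, map_mul, map_inv]
end

section
/- Let δ : X → G and δ' : X' → G' be crossed modules of groups, let P be a set, and let u : P × X → X' and v : P × G → G' be maps such that for each p ∈ P the maps u(p, ·) : X → X' and v(p, ·) : G → G' are group homomorphisms and δ'(u(p, x)) = v(p, δ(x)) for all x ∈ X. If X is perfect, then u(p, g • x) = v(p, g) • u(p, x) for all p ∈ P, g ∈ G and x ∈ X. In particular, given a group homomorphism δ : X → G with X perfect, there is at most one action of G on X making δ a crossed module. -/
/-- A crossed module of groups: an action `a` of `G` on `X` by group automorphisms together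
with a homomorphism `δ : X →* G` that is equivariant for the conjugation action of `G` on
itself and satisfies the Peiffer identity. -/
structure IsCrossedModule {X G : Type*} [Group X] [Group G]
    (δ : X →* G) (a : G → X → X) : Prop where
  smul_mul : ∀ g x y, a g (x * y) = a g x * a g y
  one_smul : ∀ x, a 1 x = x
  mul_smul : ∀ g h x, a (g * h) x = a g (a h x)
  equivariant : ∀ g x, δ (a g x) = g * δ x * g⁻¹
  peiffer : ∀ x y, a (δ x) y = x * y * x⁻¹

open scoped commutatorElement in
/-- Homomorphisms out of a perfect group that agree modulo the center are equal. -/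
theorem MonoidHom.eq_of_div_mem_center {X Y : Type*} [Group X] [Group Y]
    (hX : commutator X = ⊤) (f h : X →* Y) (hc : ∀ x, f x / h x ∈ Subgroup.center Y) :
    f = h := by
  suffices H : commutator X ≤ f.eqLocus h by
    ext x
    exact H (hX ▸ Subgroup.mem_top x)
  rw [commutator_def, Subgroup.commutator_le]
  intro x _ y _
  change f ⁅x, y⁆ = h ⁅x, y⁆
  have conj_eq : ∀ x z, f x * z * (f x)⁻¹ = h x * z * (h x)⁻¹ := by
    intro x z
    have := Subgroup.mem_center_iff.mp (hc x) (h x * z * (h x)⁻¹)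
    calc
      f x * z * (f x)⁻¹ = f x / h x * (h x * z * (h x)⁻¹) * (f x / h x)⁻¹ := by
        rw [div_eq_mul_inv]; group
      _ = h x * z * (h x)⁻¹ := by rw [← this, mul_inv_cancel_right]
  have conj_eq' : h x * f y * (h x)⁻¹ * (f y)⁻¹ = h x * h y * (h x)⁻¹ * (h y)⁻¹ := by
    have := conj_eq y (h x)⁻¹
    simpa only [mul_assoc] using congrArg (h x * ·) this
  rw [map_commutatorElement, map_commutatorElement, commutatorElement_def,
    commutatorElement_def, conj_eq, conj_eq']

namespace IsCrossedModule

variable {X G X' G' : Type*} [Group X] [Group G] [Group X'] [Group G']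
  {δ : X →* G} {a : G → X → X} {δ' : X' →* G'} {a' : G' → X' → X'}

/-- The endomorphism of `X` by which an element of `G` acts. -/
def actionHom (hδ : IsCrossedModule δ a) (g : G) : X →* X :=
  MonoidHom.mk' (a g) (hδ.smul_mul g)

theorem ker_le_center (hδ : IsCrossedModule δ a) : δ.ker ≤ Subgroup.center X := by
  intro x hx
  rw [Subgroup.mem_center_iff]
  intro y
  have := hδ.peiffer x y
  rw [MonoidHom.mem_ker.mp hx, hδ.one_smul] at this
  exact eq_mul_inv_iff_mul_eq.mp this

theorem map_action_of_perfect (hδ : IsCrossedModule δ a) (hδ' : IsCrossedModule δ' a')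
    (hX : commutator X = ⊤) (u : X →* X') (v : G →* G') (huv : ∀ x, δ' (u x) = v (δ x))
    (g : G) (x : X) : u (a g x) = a' (v g) (u x) := by
  refine DFunLike.congr_fun (MonoidHom.eq_of_div_mem_center hX
    (u.comp (hδ.actionHom g)) ((hδ'.actionHom (v g)).comp u) fun x ↦ hδ'.ker_le_center ?_) x
  change δ' (u (a g x) / a' (v g) (u x)) = 1
  rw [map_div, huv, hδ.equivariant, hδ'.equivariant, huv]
  simp

end IsCrossedModule

/-- Given crossed modules `δ : X → G` and `δ' : X' → G'`, a set `P`, and families of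
homomorphisms `u p : X → X'`, `v p : G → G'` with `δ' ∘ u p = v p ∘ δ`, if `X` is perfect
then each `u p` is equivariant over `v p`. In particular, for `δ : X →* G` with `X` perfect
there is at most one action of `G` on `X` making `δ` a crossed module. -/
theorem equivariant_of_perfect {X G X' G' P : Type*} [Group X] [Group G] [Group X'] [Group G']
    (δ : X →* G) (a : G → X → X) (hδ : IsCrossedModule δ a)
    (δ' : X' →* G') (a' : G' → X' → X') (hδ' : IsCrossedModule δ' a')
    (u : P → X → X') (v : P → G → G')
    (hu : ∀ p x y, u p (x * y) = u p x * u p y)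
    (hv : ∀ p g h, v p (g * h) = v p g * v p h)
    (hcompat : ∀ p x, δ' (u p x) = v p (δ x))
    (hperf : commutator X = ⊤) :
    (∀ p g x, u p (a g x) = a' (v p g) (u p x)) ∧
      ∀ a₁ a₂ : G → X → X, IsCrossedModule δ a₁ → IsCrossedModule δ a₂ → a₁ = a₂ := by
  exact ⟨fun p ↦ hδ.map_action_of_perfect hδ' hperf (.mk' (u p) (hu p)) (.mk' (v p) (hv p))
      (hcompat p),
    fun _ _ h₁ h₂ ↦ funext₂ <|
      h₁.map_action_of_perfect h₂ hperf (.id X) (.id G) fun _ ↦ rfl⟩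
end

section
/- Let δ : X → G and δ' : X' → G be crossed modules of groups over the same group G, and suppose X is perfect. Then there is at most one group homomorphism f : X → X' with δ' ∘ f = δ; moreover any such f is G-equivariant, i.e. f(g • x) = g • f(x) for all g ∈ G and x ∈ X. -/
namespace IsCrossedModule

variable {X Y G : Type*} [Group X] [Group Y] [Group G] {δ : X →* G} {a : G → X → X}

/-- The group automorphisms of `X` given by the action of `G`, as endomorphisms. -/
def toEnd (h : IsCrossedModule δ a) (g : G) : X →* X :=
  MonoidHom.mk' (a g) (h.smul_mul g)

theorem conj_eq_of_map_eq (h : IsCrossedModule δ a) {x y : X} (hxy : δ x = δ y) (z : X) :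
    x * z * x⁻¹ = y * z * y⁻¹ := by
  rw [← h.peiffer, ← h.peiffer, hxy]

open scoped commutatorElement in
theorem commutatorElement_eq_of_map_eq (h : IsCrossedModule δ a) {x₁ x₂ y₁ y₂ : X}
    (hx : δ x₁ = δ x₂) (hy : δ y₁ = δ y₂) : ⁅x₁, y₁⁆ = ⁅x₂, y₂⁆ := by
  calc ⁅x₁, y₁⁆ = x₁ * y₁ * x₁⁻¹ * y₁⁻¹ := commutatorElement_def x₁ y₁
    _ = x₂ * (y₁ * x₂⁻¹ * y₁⁻¹) := by rw [h.conj_eq_of_map_eq hx]; group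
    _ = x₂ * (y₂ * x₂⁻¹ * y₂⁻¹) := by rw [h.conj_eq_of_map_eq hy]
    _ = ⁅x₂, y₂⁆ := by rw [commutatorElement_def]; group

/-- Homomorphisms from a perfect group into a crossed module are determined by their composite
with the boundary map. -/
theorem hom_ext_of_perfect (h : IsCrossedModule δ a) (hperf : commutator Y = ⊤)
    {f₁ f₂ : Y →* X} (hf : ∀ y, δ (f₁ y) = δ (f₂ y)) : f₁ = f₂ := by
  have hle : commutator Y ≤ f₁.eqLocus f₂ := by
    rw [commutator_def, Subgroup.commutator_le]
    intro x _ y _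
    change f₁ _ = f₂ _
    rw [map_commutatorElement, map_commutatorElement]
    exact h.commutatorElement_eq_of_map_eq (hf x) (hf y)
  ext y
  exact hle (hperf ▸ Subgroup.mem_top y)

end IsCrossedModule

/-- Given crossed modules `δ : X → G` and `δ' : X' → G` over the same group `G` with `X`
perfect, there is at most one homomorphism `f : X → X'` with `δ' ∘ f = δ`, and any such `f`
is `G`-equivariant. -/
theorem unique_morphism_of_crossed_modules {X X' G : Type*} [Group X] [Group X'] [Group G]
    (δ : X →* G) (a : G → X → X) (hδ : IsCrossedModule δ a)
    (δ' : X' →* G) (a' : G → X' → X') (hδ' : IsCrossedModule δ' a')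
    (hperf : commutator X = ⊤) :
    (∀ f₁ f₂ : X →* X', δ'.comp f₁ = δ → δ'.comp f₂ = δ → f₁ = f₂) ∧
      ∀ f : X →* X', δ'.comp f = δ → ∀ g x, f (a g x) = a' g (f x) := by
  refine ⟨fun f₁ f₂ h₁ h₂ ↦ hδ'.hom_ext_of_perfect hperf (DFunLike.congr_fun (h₁.trans h₂.symm)),
    fun f hf g ↦ ?_⟩
  have hf' (x : X) : δ' (f x) = δ x := DFunLike.congr_fun hf x
  have key : f.comp (hδ.toEnd g) = (hδ'.toEnd g).comp f := by
    refine hδ'.hom_ext_of_perfect hperf fun x ↦ ?_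
    change δ' (f (a g x)) = δ' (a' g (f x))
    rw [hf', hδ.equivariant, hδ'.equivariant, hf']
  exact DFunLike.congr_fun key
end

section
/- Let δ : X → G be a crossed module of groups with X perfect. Let H be a group acting on X by group automorphisms and let π : H → G be a group homomorphism such that δ(h • x) = π(h) * δ(x) * π(h)⁻¹ for all h ∈ H and x ∈ X. Then every element h of the kernel of π acts trivially on X, i.e. h • x = x for all x ∈ X. -/
open scoped commutatorElement

/-- Conjugation in `X` depends only on the image under `δ`. -/
theorem IsCrossedModule.conj_eq_of_map_eq_s11 {X G : Type*} [Group X] [Group G]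
    {δ : X →* G} {a : G → X → X} (hδ : IsCrossedModule δ a) {x y : X} (hxy : δ x = δ y) (z : X) :
    x * z * x⁻¹ = y * z * y⁻¹ := by
  rw [← hδ.peiffer, ← hδ.peiffer, hxy]

/-- Homomorphisms from a perfect group into `X` are determined by their composition with `δ`. -/
theorem IsCrossedModule.hom_ext_of_commutator_eq_top {X G Y : Type*} [Group X] [Group G] [Group Y]
    {δ : X →* G} {a : G → X → X} (hδ : IsCrossedModule δ a) (hY : commutator Y = ⊤)
    {f g : Y →* X} (hfg : δ.comp f = δ.comp g) : f = g := by
  have hconj (y : Y) (z : X) : f y * z * (f y)⁻¹ = g y * z * (g y)⁻¹ :=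
    hδ.conj_eq_of_map_eq_s11 (DFunLike.congr_fun hfg y) z
  have hle : commutator Y ≤ f.eqLocus g := by
    rw [commutator_def, Subgroup.commutator_le]
    intro x _ y _
    change f ⁅x, y⁆ = g ⁅x, y⁆
    rw [map_commutatorElement, map_commutatorElement, commutatorElement_def,
      commutatorElement_def, hconj x]
    simpa only [mul_assoc] using congrArg (g x * ·) (hconj y (g x)⁻¹)
  exact MonoidHom.eq_of_eqOn_top fun y hy => hle (hY.symm ▸ hy)

/-- Let `δ : X → G` be a crossed module with `X` perfect, and let `H` act on `X` by
automorphisms via `b`, with `π : H →* G` satisfying `δ (b h x) = π h * δ x * (π h)⁻¹`.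
Then every element of the kernel of `π` acts trivially on `X`. -/
theorem ker_acts_trivially {X G H : Type*} [Group X] [Group G] [Group H]
    (δ : X →* G) (a : G → X → X) (hδ : IsCrossedModule δ a)
    (hperf : commutator X = ⊤)
    (b : H → X → X)
    (hb_mul : ∀ h x y, b h (x * y) = b h x * b h y)
    (hb_one : ∀ x, b 1 x = x)
    (hb_comp : ∀ h h' x, b (h * h') x = b h (b h' x))
    (π : H →* G)
    (hcompat : ∀ h x, δ (b h x) = π h * δ x * (π h)⁻¹) :
    ∀ h ∈ π.ker, ∀ x : X, b h x = x := by
  intro h hh x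
  have hfix : δ.comp (MonoidHom.mk' (b h) (hb_mul h)) = δ.comp (MonoidHom.id X) := by
    ext y
    simp [hcompat, MonoidHom.mem_ker.mp hh]
  exact DFunLike.congr_fun (hδ.hom_ext_of_commutator_eq_top hperf hfix) x
end

section
/- Let C be a small category and X an object of C. Then the canonical functor from the ind-completion Ind(C/X) of the slice category C/X to the slice category Ind(C)/ι(X) of the ind-completion of C over the image ι(X) of X is an equivalence of categories. Concretely: there is an equivalence E : Ind(C/X) ≌ Ind(C)/ι(X) such that the composite of the canonical embedding C/X ⥤ Ind(C/X) with E is naturally isomorphic to the functor C/X ⥤ Ind(C)/ι(X) induced by the canonical fully faithful embedding ι : C ⥤ Ind(C). -/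
open CategoryTheory

universe u

namespace CategoryTheory

open CategoryTheory.Functor Limits

universe v₁ v₂ v₃ u₁ u₂ u₃

/-- Two fully faithful functors with the same essential image have equivalent sources. -/
theorem exists_equivalence_of_essImage_eq {A : Type u₁} [Category.{v₁} A] {B : Type u₂}
    [Category.{v₂} B] {D : Type u₃} [Category.{v₃} D] (F : A ⥤ D) (G : B ⥤ D)
    [F.Full] [F.Faithful] [G.Full] [G.Faithful] (h : F.essImage = G.essImage) :
    ∃ E : A ≌ B, Nonempty (E.functor ⋙ G ≅ F) := by
  let E : A ≌ B := F.toEssImage.asEquivalence.trans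
    ((ObjectProperty.fullSubcategoryCongr h).trans G.toEssImage.asEquivalence.symm)
  refine ⟨E, ⟨?_⟩⟩
  exact isoWhiskerLeft E.functor G.toEssImageCompι.symm ≪≫
    isoWhiskerRight (isoWhiskerLeft
      (F.toEssImage ⋙ (ObjectProperty.fullSubcategoryCongr h).functor)
      G.toEssImage.asEquivalence.counitIso) G.essImage.ι ≪≫ F.toEssImageCompι

/-- Being an ind-object only depends on the category of elements up to equivalence. -/
theorem Limits.isIndObject_iff_of_equivalence {C D : Type u} [SmallCategory C] [SmallCategory D]
    {A : Cᵒᵖ ⥤ Type u} {B : Dᵒᵖ ⥤ Type u}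
    (e : CostructuredArrow yoneda A ≌ CostructuredArrow yoneda B) :
    IsIndObject A ↔ IsIndObject B := by
  have : EssentiallySmall.{u} (CostructuredArrow yoneda A) :=
    essentiallySmallSelf _
  have : EssentiallySmall.{u} (CostructuredArrow yoneda B) :=
    essentiallySmallSelf _
  rw [isIndObject_iff, isIndObject_iff]
  exact ⟨fun ⟨_, _⟩ ↦ ⟨.of_equivalence e, finallySmall_of_essentiallySmall _⟩,
    fun ⟨_, _⟩ ↦ ⟨.of_equivalence e.symm, finallySmall_of_essentiallySmall _⟩⟩

section

variable {C : Type u} [SmallCategory C] (X : C)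

/-- The slice `C/X` is equivalent to the category of elements of the presheaf represented
by `X`. -/
def overToCostructuredArrowYoneda : Over X ⥤ CostructuredArrow yoneda (yoneda.obj X) :=
  CostructuredArrow.post (𝟭 C) yoneda X

instance : (overToCostructuredArrowYoneda X).IsEquivalence :=
  CostructuredArrow.isEquivalence_post X (𝟭 C) yoneda

/-- Presheaves over a representable presheaf, regarded as presheaves on the slice category. -/
def overYonedaToPresheafOver : Over (yoneda.obj X) ⥤ (Over X)ᵒᵖ ⥤ Type u :=
  (overEquivPresheafCostructuredArrow (yoneda.obj X)).functor ⋙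
    (whiskeringLeft _ _ _).obj (overToCostructuredArrowYoneda X).op

instance : (overYonedaToPresheafOver X).IsEquivalence := by
  unfold overYonedaToPresheafOver
  infer_instance

/-- The equivalence between presheaves over `yoneda.obj X` and presheaves on `Over X` is compatible
with the Yoneda embeddings. -/
noncomputable def postYonedaCompOverYonedaToPresheafOver :
    Over.post (X := X) yoneda ⋙ overYonedaToPresheafOver X ≅ yoneda :=
  isoWhiskerLeft (overToCostructuredArrowYoneda X)
    (isoWhiskerRight (CostructuredArrow.toOverCompOverEquivPresheafCostructuredArrow _)
      ((whiskeringLeft _ _ _).obj (overToCostructuredArrowYoneda X).op)) ≪≫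
  NatIso.ofComponents (fun Y ↦ NatIso.ofComponents (fun Z ↦
    ((FullyFaithful.ofFullyFaithful (overToCostructuredArrowYoneda X)).homEquiv (X := Z.unop)
      (Y := Y)).symm.toIso)
    (fun f ↦ by
      ext g
      exact (FullyFaithful.ofFullyFaithful (overToCostructuredArrowYoneda X)).map_injective
        (by simp)))
    (fun f ↦ by
      ext Z g
      exact (FullyFaithful.ofFullyFaithful (overToCostructuredArrowYoneda X)).map_injective
        (by simp))

/-- A presheaf over `yoneda.obj X` and the corresponding presheaf on `Over X` have equivalent
categories of elements. -/
noncomputable def costructuredArrowYonedaEquivalence (B : Over (yoneda.obj X)) :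
    CostructuredArrow yoneda ((overYonedaToPresheafOver X).obj B) ≌
      CostructuredArrow yoneda B.left :=
  (CostructuredArrow.mapNatIso (postYonedaCompOverYonedaToPresheafOver X)).symm.trans <|
    (CostructuredArrow.post (Over.post yoneda)
      (overYonedaToPresheafOver X) B).asEquivalence.symm.trans <|
    (CostructuredArrow.pre (overToCostructuredArrowYoneda X)
      (CostructuredArrow.toOver yoneda (yoneda.obj X)) B).asEquivalence.trans <|
    CostructuredArrow.costructuredArrowToOverEquivalence yoneda B

theorem isIndObject_overYonedaToPresheafOver_obj_iff (B : Over (yoneda.obj X)) :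
    IsIndObject ((overYonedaToPresheafOver X).obj B) ↔ IsIndObject B.left :=
  isIndObject_iff_of_equivalence (costructuredArrowYonedaEquivalence X B)

theorem Ind.essImage_inclusion : (Ind.inclusion C).essImage = IsIndObject := by
  ext A
  refine ⟨fun ⟨B, ⟨e⟩⟩ ↦ B.isIndObject_inclusion_obj.map e.hom, fun h ↦ ?_⟩
  exact ⟨(Ind.equivalence C).inverse.obj ⟨A, h⟩,
    ⟨(ObjectProperty.ι _).mapIso ((Ind.equivalence C).counitIso.app ⟨A, h⟩)⟩⟩

/-- Ind-objects over `X`, regarded as presheaves over `yoneda.obj X`. -/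
noncomputable def Ind.overInclusion : Over (Ind.yoneda.obj X) ⥤ Over (yoneda.obj X) :=
  Over.post (Ind.inclusion C) ⋙ Over.map (Ind.yonedaCompInclusion.hom.app X)

instance : (Ind.overInclusion X).Full := by
  unfold Ind.overInclusion
  infer_instance

instance : (Ind.overInclusion X).Faithful := by
  unfold Ind.overInclusion
  infer_instance

/-- The inclusion of ind-objects over `X` into presheaves is compatible with the Yoneda
embeddings. -/
noncomputable def Ind.postYonedaCompOverInclusion :
    Over.post Ind.yoneda ⋙ Ind.overInclusion X ≅ Over.post yoneda :=
  Over.postCongr (X := X) Ind.yonedaCompInclusion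

theorem Ind.essImage_overInclusion_iff (B : Over (yoneda.obj X)) :
    (Ind.overInclusion X).essImage B ↔ IsIndObject B.left := by
  refine ⟨fun ⟨Y, ⟨e⟩⟩ ↦ ?_, fun h ↦ ?_⟩
  · exact (IsIndObject.iff_of_iso ((Over.forget _).mapIso e).hom).1
      Y.left.isIndObject_inclusion_obj
  · rw [← Ind.essImage_inclusion] at h
    obtain ⟨A, ⟨e⟩⟩ := h
    exact ⟨Over.mk ((Ind.inclusion C).preimage
        (e.hom ≫ B.hom ≫ Ind.yonedaCompInclusion.inv.app X)),
      ⟨Over.isoMk e (by simp [Ind.overInclusion, Over.post])⟩⟩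

theorem Ind.essImage_overInclusion_comp :
    (Ind.overInclusion X ⋙ overYonedaToPresheafOver X).essImage = IsIndObject := by
  ext F
  refine ⟨fun ⟨Y, ⟨e⟩⟩ ↦ ?_, fun h ↦ ?_⟩
  · refine IsIndObject.map e.hom ((isIndObject_overYonedaToPresheafOver_obj_iff X _).2 ?_)
    exact (Ind.essImage_overInclusion_iff X _).1 (obj_mem_essImage _ Y)
  · let e := (overYonedaToPresheafOver X).objObjPreimageIso F
    obtain ⟨Y, ⟨i⟩⟩ := (Ind.essImage_overInclusion_iff X _).2
      ((isIndObject_overYonedaToPresheafOver_obj_iff X _).1 (h.map e.inv))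
    exact ⟨Y, ⟨(overYonedaToPresheafOver X).mapIso i ≪≫ e⟩⟩

end

end CategoryTheory

/-- For a small category `C` and an object `X` of `C`, the canonical functor
`Ind (C/X) ⥤ Ind C / ι X` is an equivalence: there is an equivalence
`E : Ind (C/X) ≌ Ind C / ι X` whose composite with the canonical embedding
`C/X ⥤ Ind (C/X)` is naturally isomorphic to the functor `C/X ⥤ Ind C / ι X`
induced by the embedding `ι : C ⥤ Ind C`. -/
theorem ind_over_equivalence {C : Type u} [SmallCategory C] (X : C) :
    ∃ E : Ind (Over X) ≌ Over (Ind.yoneda.obj X),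
      Nonempty ((Ind.yoneda ⋙ E.functor) ≅ Over.post Ind.yoneda) := by
  obtain ⟨E, ⟨i⟩⟩ := exists_equivalence_of_essImage_eq (Ind.inclusion (Over X))
    (Ind.overInclusion X ⋙ overYonedaToPresheafOver X)
    (Ind.essImage_inclusion.trans (Ind.essImage_overInclusion_comp X).symm)
  refine ⟨E, ⟨Functor.fullyFaithfulCancelRight
    (Ind.overInclusion X ⋙ overYonedaToPresheafOver X) ?_⟩⟩
  exact Functor.isoWhiskerLeft Ind.yoneda i ≪≫ Ind.yonedaCompInclusion ≪≫
    (postYonedaCompOverYonedaToPresheafOver X).symm ≪≫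
    Functor.isoWhiskerRight (Ind.postYonedaCompOverInclusion X).symm (overYonedaToPresheafOver X)
end

section
/- Let C be a small category with finite limits in which every kernel pair has a coequalizer and regular epimorphisms are stable under pullback (a regular category). If X is an object of C such that for every regular epimorphism f : Y → Z in C the induced map Hom(X, Y) → Hom(X, Z) is surjective (i.e. X is projective with respect to regular epimorphisms), then the image ι(X) of X under the canonical embedding ι : C ⥤ Ind(C) has the same property in Ind(C): for every regular epimorphism g : A → B in Ind(C), the induced map Hom(ι(X), A) → Hom(ι(X), B) is surjective. -/
open CategoryTheory CategoryTheory.Limits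

universe u v

namespace CategoryTheory

/-- A category with finite limits, coequalizers of the chosen kernel pairs, and regular
epimorphisms stable under the chosen pullbacks is regular. -/
theorem Regular.of_pullback {C : Type u} [Category.{v} C] [HasFiniteLimits C]
    (hcoeq : ∀ {Y Z : C} (f : Y ⟶ Z), HasCoequalizer (pullback.fst f f) (pullback.snd f f))
    (hstab : ∀ {Y Z W : C} (f : Y ⟶ Z) (g : W ⟶ Z),
      IsRegularEpi f → IsRegularEpi (pullback.snd f g)) : Regular C where
  hasCoequalizer_of_isKernelPair {X Y Z f g₁ g₂} h := by
    have := hcoeq f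
    exact hasColimit_of_iso (F := parallelPair (pullback.fst f f) (pullback.snd f f))
      (parallelPair.ext h.isoPullback (Iso.refl _) (by simp) (by simp))
  regularEpiIsStableUnderBaseChange := by
    refine .mk' fun X Y S f g _ hg ↦ ?_
    have := hstab g f hg
    rw [MorphismProperty.regularEpi_iff, ← pullbackSymmetry_hom_comp_snd]
    exact (MorphismProperty.regularEpi C).cancel_left_of_respectsIso _ _ |>.2 this

/-- Morphisms from a representable ind-object to a filtered colimit factor through the diagram. -/
theorem Ind.exists_fac_of_isColimit {C : Type u} [Category.{v} C] {I : Type v} [SmallCategory I]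
    [IsFiltered I] {K : I ⥤ Ind C} {c : Cocone K} (hc : IsColimit c) {X : C}
    (f : Ind.yoneda.obj X ⟶ c.pt) : ∃ (i : I) (g : Ind.yoneda.obj X ⟶ K.obj i),
      g ≫ c.ι.app i = f := by
  let e := Ind.yonedaCompInclusion.app X
  obtain ⟨i, y, hy⟩ := Types.jointly_surjective_of_isColimit
    (isColimitOfPreserves (Ind.inclusion C ⋙ (evaluation _ _).obj (Opposite.op X)) hc)
    (yonedaEquiv (e.inv ≫ (Ind.inclusion C).map f))
  refine ⟨i, (Ind.inclusion C).preimage (e.hom ≫ yonedaEquiv.symm y),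
    (Ind.inclusion C).map_injective ?_⟩
  rw [Functor.map_comp, Functor.map_preimage, Category.assoc, ← Iso.eq_inv_comp]
  apply yonedaEquiv.injective
  rw [yonedaEquiv_comp, Equiv.apply_symm_apply]
  exact hy

/-- In a category with strong epi images, natural transformations factor pointwise as strong
epimorphisms followed by monomorphisms. -/
theorem NatTrans.exists_strongEpi_mono_fac {C : Type u} [Category.{v} C] [HasImages C]
    [HasStrongEpiImages C] {I : Type*} [Category* I] {F G : I ⥤ C} (φ : F ⟶ G) :
    ∃ (H : I ⥤ C) (e : F ⟶ H) (m : H ⟶ G), (∀ i, StrongEpi (e.app i)) ∧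
      (∀ i, Mono (m.app i)) ∧ e ≫ m = φ :=
  let T : I ⥤ Arrow C :=
    { obj := fun i ↦ Arrow.mk (φ.app i)
      map := fun f ↦ Arrow.homMk (F.map f) (G.map f) (by simp) }
  ⟨T ⋙ im, { app := fun i ↦ factorThruImage (φ.app i)
             naturality := fun i j f ↦ (image.factor_map (T.map f)).symm },
    { app := fun i ↦ image.ι (φ.app i)
      naturality := fun i j f ↦ image.map_ι (T.map f) },
    fun i ↦ inferInstanceAs (StrongEpi (factorThruImage (φ.app i))),
    fun i ↦ inferInstanceAs (Mono (image.ι (φ.app i))),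
    by ext i; exact image.fac (φ.app i)⟩

/-- The canonical morphism from a term of a filtered diagram to its ind-limit. -/
noncomputable def Ind.ιLim {C : Type u} [Category.{v} C] {I : Type v} [SmallCategory I]
    [IsFiltered I] (F : I ⥤ C) (i : I) : Ind.yoneda.obj (F.obj i) ⟶ (Ind.lim I).obj F :=
  colimit.ι (F ⋙ Ind.yoneda) i

theorem Ind.ιLim_map {C : Type u} [Category.{v} C] {I : Type v} [SmallCategory I]
    [IsFiltered I] {F G : I ⥤ C} (φ : F ⟶ G) (i : I) :
    Ind.ιLim F i ≫ (Ind.lim I).map φ = Ind.yoneda.map (φ.app i) ≫ Ind.ιLim G i :=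
  ι_colimMap _ _

/-- Morphisms from a representable ind-object to an ind-limit come from a term of the diagram. -/
theorem Ind.exists_map_comp_ιLim {C : Type u} [Category.{v} C] {I : Type v} [SmallCategory I]
    [IsFiltered I] {F : I ⥤ C} {X : C} (f : Ind.yoneda.obj X ⟶ (Ind.lim I).obj F) :
    ∃ (i : I) (g : X ⟶ F.obj i), Ind.yoneda.map g ≫ Ind.ιLim F i = f := by
  obtain ⟨i, g, hg⟩ := Ind.exists_fac_of_isColimit (colimit.isColimit (F ⋙ Ind.yoneda)) f
  obtain ⟨g, rfl⟩ := Ind.yoneda.map_surjective g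
  exact ⟨i, g, hg⟩

/-- If `X` is projective with respect to regular epimorphisms in a regular category, then its image
in the ind-completion is projective with respect to strong epimorphisms. -/
theorem Ind.exists_lift_yoneda {C : Type u} [Category.{v} C] [Regular C] {X : C}
    (hX : ∀ {Y Z : C} (f : Y ⟶ Z) [IsRegularEpi f] (h : X ⟶ Z), ∃ k : X ⟶ Y, k ≫ f = h)
    {A B : Ind C} (g : A ⟶ B) [StrongEpi g] (h : Ind.yoneda.obj X ⟶ B) :
    ∃ k : Ind.yoneda.obj X ⟶ A, k ≫ g = h := by
  obtain ⟨I, _, _, F, G, φ, ⟨a⟩⟩ := Ind.exists_nonempty_arrow_mk_iso_ind_lim (f := g)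
  obtain ⟨H, e, m, he, hm, rfl⟩ := NatTrans.exists_strongEpi_mono_fac φ
  have : Mono m := NatTrans.mono_of_mono_app m
  have : StrongEpi ((Ind.lim I).map e ≫ (Ind.lim I).map m) := by
    rw [← Functor.map_comp]
    exact StrongEpi.of_arrow_iso (f := g) a
  have : StrongEpi ((Ind.lim I).map m) := strongEpi_of_strongEpi ((Ind.lim I).map e) _
  have : IsIso ((Ind.lim I).map m) := isIso_of_mono_of_strongEpi _
  let l : (Ind.lim I).obj F ⟶ A := a.inv.left
  let r : (Ind.lim I).obj G ⟶ B := a.inv.right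
  let s : B ⟶ (Ind.lim I).obj G := a.hom.right
  have hl : l ≫ g = (Ind.lim I).map (e ≫ m) ≫ r := a.inv.w
  have hs : s ≫ r = 𝟙 B := Arrow.hom_inv_id_right a
  obtain ⟨i, y, hy⟩ := Ind.exists_map_comp_ιLim (h ≫ s ≫ inv ((Ind.lim I).map m))
  obtain ⟨k, rfl⟩ := hX (e.app i) y
  have hk : (Ind.yoneda.map k ≫ Ind.ιLim F i) ≫ (Ind.lim I).map e =
      h ≫ s ≫ inv ((Ind.lim I).map m) := by
    rw [Category.assoc, Ind.ιLim_map, ← Category.assoc, ← Functor.map_comp, hy]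
  refine ⟨(Ind.yoneda.map k ≫ Ind.ιLim F i) ≫ l, ?_⟩
  rw [Category.assoc, hl, Functor.map_comp, ← Category.assoc, ← Category.assoc, hk]
  simp only [Category.assoc, IsIso.inv_hom_id_assoc, hs, Category.comp_id]

end CategoryTheory

/-- Let `C` be a small regular category (finite limits, coequalizers of kernel pairs, and
regular epimorphisms stable under pullback). If `X` is projective with respect to regular
epimorphisms in `C`, then `ι X` is projective with respect to regular epimorphisms in
`Ind C`. -/
theorem ind_yoneda_projective_of_projective {C : Type u} [SmallCategory C]
    [HasFiniteLimits C]
    (hcoeq : ∀ {Y Z : C} (f : Y ⟶ Z),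
      HasCoequalizer (pullback.fst f f) (pullback.snd f f))
    (hstab : ∀ {Y Z W : C} (f : Y ⟶ Z) (g : W ⟶ Z),
      Nonempty (RegularEpi f) → Nonempty (RegularEpi (pullback.snd f g)))
    (X : C)
    (hX : ∀ {Y Z : C} (f : Y ⟶ Z), Nonempty (RegularEpi f) →
      Function.Surjective (fun h : X ⟶ Y => h ≫ f)) :
    ∀ {A B : Ind C} (g : A ⟶ B), Nonempty (RegularEpi g) →
      Function.Surjective (fun h : Ind.yoneda.obj X ⟶ A => h ≫ g) := by
  intro A B g hg h
  have : Regular C := .of_pullback hcoeq fun f g hf ↦ ⟨hstab f g hf.regularEpi⟩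
  have : IsRegularEpi g := ⟨hg⟩
  exact Ind.exists_lift_yoneda (fun f hf ↦ hX f hf.regularEpi) g h
end
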